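/- arXiv:1611.05220 — 2 statements merged into one kernel-verified Lean document; each statement's English description precedes it below -/
import Mathlib

section
/- Let α ∈ (1,2) and δ > 0. Then there exists an even convex function φ : ℝ → [0,∞) with φ(0) = 0 whose derivative is concave on (0,∞), such that the function ℓ(x) := φ(x)x^{−α} (x > 0) is increasing and satisfies: (i) ℓ(x^{−1}) = ℓ(x)^{−1} > 0 for all x > 0; (ii) there is a constant c > 0 with ℓ(x) ∼ c·log^δ(x) as x → ∞; (iii) ℓ(xy) ≤ ℓ(x)² ℓ(y) for all x ≥ 1 and y > 0. -/
open Filter Topology Set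

namespace TVaux

/-- reciprocal of `sqrt (1+s^2)` -/
noncomputable def w (s : ℝ) : ℝ := (Real.sqrt (1 + s ^ 2))⁻¹

lemma sq_pos' (s : ℝ) : 0 < 1 + s ^ 2 := by positivity

lemma w_pos (s : ℝ) : 0 < w s := inv_pos.2 (Real.sqrt_pos.2 (sq_pos' s))

lemma w_sq (s : ℝ) : w s ^ 2 * (1 + s ^ 2) = 1 := by
  unfold w
  rw [inv_pow, Real.sq_sqrt (sq_pos' s).le]
  exact inv_mul_cancel₀ (sq_pos' s).ne'

lemma w_le (s : ℝ) : w s ≤ 1 := by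
  have h := w_sq s
  have h0 := w_pos s
  nlinarith [mul_nonneg (sq_nonneg (w s)) (sq_nonneg s)]

lemma hasDerivAt_w (s : ℝ) : HasDerivAt w (-(s * w s ^ 3)) s := by
  have h1 : HasDerivAt (fun s : ℝ => 1 + s ^ 2) (2 * s) s := by
    simpa using ((hasDerivAt_pow 2 s).const_add 1)
  have h2 := (h1.sqrt (sq_pos' s).ne').inv (Real.sqrt_pos.2 (sq_pos' s)).ne'
  refine h2.congr_deriv ?_
  unfold w
  have := (Real.sqrt_pos.2 (sq_pos' s)).ne'
  field_simp

lemma hasDerivAt_sw (s : ℝ) :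
    HasDerivAt (fun s => -(s * w s ^ 3)) (w s ^ 3 * (3 * (s ^ 2 * w s ^ 2) - 1)) s := by
  have h := ((hasDerivAt_id s).mul ((hasDerivAt_w s).pow 3)).neg
  refine h.congr_deriv ?_
  simp
  ring

lemma sw_le (s : ℝ) : |s * w s ^ 3| ≤ 1 := by
  have h := w_sq s
  have h0 := w_pos s
  have h1 := w_le s
  have h2 : (s * w s) ^ 2 ≤ 1 := by nlinarith [sq_nonneg (w s)]
  have h3 : |s * w s| ≤ 1 := by
    rw [← sq_abs] at h2
    nlinarith [abs_nonneg (s * w s)]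
  have h4 : s * w s ^ 3 = (s * w s) * w s ^ 2 := by ring
  rw [h4, abs_mul, abs_of_nonneg (sq_nonneg (w s))]
  have h5 : w s ^ 2 ≤ 1 := by nlinarith
  exact mul_le_one₀ h3 (sq_nonneg _) h5

lemma r_le (s : ℝ) : w s ^ 3 * (3 * (s ^ 2 * w s ^ 2) - 1) ≤ 2 := by
  have h := w_sq s
  have h0 := w_pos s
  have h1 := w_le s
  have h2 : 3 * (s ^ 2 * w s ^ 2) - 1 ≤ 2 := by nlinarith [sq_nonneg (w s)]
  have h3 : w s ^ 3 ≤ 1 := pow_le_one₀ h0.le h1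
  have h4 : 0 ≤ w s ^ 3 := by positivity
  nlinarith

lemma key_deriv (β : ℝ) (g m : ℝ → ℝ) (p m' x : ℝ) (hx : 0 < x)
    (hg : HasDerivAt g p (Real.log x)) (hm : HasDerivAt m m' (Real.log x)) :
    HasDerivAt (fun x => x ^ β * Real.exp (g (Real.log x)) * m (Real.log x))
      (x ^ (β - 1) * Real.exp (g (Real.log x)) * ((β + p) * m (Real.log x) + m')) x := by
  have hl := Real.hasDerivAt_log hx.ne'
  have h1 := Real.hasDerivAt_rpow_const (x := x) (p := β) (Or.inl hx.ne')
  have h2 := (hg.comp x hl).exp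
  have h3 := hm.comp x hl
  refine ((h1.mul h2).mul h3).congr_deriv ?_
  simp only [Function.comp, Pi.mul_apply]
  rw [Real.rpow_sub_one hx.ne']
  field_simp

lemma arsinh_ineq (s t : ℝ) (hs : 0 ≤ s) :
    Real.arsinh (s + t) ≤ 2 * Real.arsinh s + Real.arsinh t := by
  obtain ⟨a, rfl⟩ : ∃ a, s = Real.sinh a := ⟨Real.arsinh s, (Real.sinh_arsinh s).symm⟩
  obtain ⟨b, rfl⟩ : ∃ a, t = Real.sinh a := ⟨Real.arsinh t, (Real.sinh_arsinh t).symm⟩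
  rw [Real.arsinh_sinh, Real.arsinh_sinh, ← Real.sinh_le_sinh, Real.sinh_arsinh]
  have h1 : Real.sinh (2 * a + b) = Real.sinh ((a + b) + a) := by ring_nf
  have h2 : Real.sinh b = Real.sinh ((a + b) - a) := by ring_nf
  rw [h1, h2, Real.sinh_add, Real.sinh_sub]
  nlinarith [Real.one_le_cosh (a + b)]

lemma m3_neg (α ε p q r : ℝ) (h1 : 1 < α) (h2 : α < 2) (hε : ε = (2 - α) * (α - 1) / 14)
    (hp0 : 0 ≤ p) (hp : p ≤ ε) (hq : |q| ≤ ε) (hr : r ≤ ε) :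
    0 ≤ (α - 1 + p) * (α + p) + q ∧
    (α - 2 + p) * ((α - 1 + p) * (α + p) + q) + ((2 * α - 1 + 2 * p) * q + r) ≤ 0 := by
  obtain ⟨hq1, hq2⟩ := abs_le.1 hq
  have a1 : 0 < 2 - α := by linarith
  have a2 : 0 < α - 1 := by linarith
  have e1 : ε ≤ (2 - α) / 14 := by rw [hε]; nlinarith
  have e2 : ε ≤ (α - 1) / 14 := by rw [hε]; nlinarith
  have e0 : 0 < ε := by rw [hε]; positivity
  have b1 : (α - 1) * 1 ≤ (α - 1 + p) * (α + p) :=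
    mul_le_mul (by linarith) (by linarith) zero_le_one (by linarith)
  refine ⟨by linarith, ?_⟩
  have b2 : (2 - α) / 2 * ((α - 1) * 1) ≤ (2 - α - p) * ((α - 1 + p) * (α + p)) :=
    mul_le_mul (by linarith) b1 (by linarith) (by linarith)
  have b3 : (3 * (α - 1) + 3 * p) * q ≤ 6 * ε := by
    have : (3 * (α - 1) + 3 * p) * q ≤ (3 * (α - 1) + 3 * p) * ε :=
      mul_le_mul_of_nonneg_left hq2 (by linarith)
    have : (3 * (α - 1) + 3 * p) * ε ≤ 6 * ε :=
      mul_le_mul_of_nonneg_right (by linarith) e0.le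
    linarith
  have b4 : (2 - α) / 2 * ((α - 1) * 1) = 7 * ε := by rw [hε]; ring
  linarith

lemma lim_aux : Tendsto (fun y : ℝ => (y + Real.sqrt (1 + y ^ 2)) / (2 * y)) atTop (𝓝 1) := by
  have h : Tendsto (fun y : ℝ => (1 + Real.sqrt (y⁻¹ ^ 2 + 1)) / 2) atTop (𝓝 ((1 + Real.sqrt ((0:ℝ) ^ 2 + 1)) / 2)) := by
    have hc : Continuous (fun z : ℝ => (1 + Real.sqrt (z ^ 2 + 1)) / 2) := by fun_prop
    exact (hc.tendsto 0).comp tendsto_inv_atTop_zero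
  have e : (1 + Real.sqrt ((0:ℝ) ^ 2 + 1)) / 2 = 1 := by norm_num
  rw [e] at h
  refine h.congr' ?_
  filter_upwards [eventually_gt_atTop 0] with y hy
  have : Real.sqrt (1 + y ^ 2) = y * Real.sqrt (y⁻¹ ^ 2 + 1) := by
    have : 1 + y ^ 2 = y ^ 2 * (y⁻¹ ^ 2 + 1) := by field_simp
    rw [this, Real.sqrt_mul (sq_nonneg y), Real.sqrt_sq hy.le]
  rw [this]
  field_simp

end TVaux

open TVaux in
/-- **Lemma A.1.** For `α ∈ (1,2)` and `δ > 0` there is an even convex function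
`φ : ℝ → [0,∞)` with `φ(0) = 0`, differentiable on `(0,∞)` with concave derivative
there, such that `ℓ(x) = φ(x) x^{-α}` is increasing on `(0,∞)` and satisfies:
(i) `ℓ(x⁻¹) = ℓ(x)⁻¹ > 0` for all `x > 0`;
(ii) `ℓ(x) ∼ c log^δ x` as `x → ∞` for some constant `c > 0`;
(iii) `ℓ(xy) ≤ ℓ(x)² ℓ(y)` for all `x ≥ 1` and `y > 0`. -/
theorem exists_TV_function (α δ : ℝ) (hα1 : 1 < α) (hα2 : α < 2) (hδ : 0 < δ) :
    ∃ φ : ℝ → ℝ, ∃ ℓ : ℝ → ℝ,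
      (∀ x : ℝ, 0 ≤ φ x) ∧
      (∀ x : ℝ, φ (-x) = φ x) ∧
      ConvexOn ℝ Set.univ φ ∧
      φ 0 = 0 ∧
      (∃ φ' : ℝ → ℝ,
        (∀ x ∈ Set.Ioi (0:ℝ), HasDerivAt φ (φ' x) x) ∧
        ConcaveOn ℝ (Set.Ioi 0) φ') ∧
      (∀ x ∈ Set.Ioi (0:ℝ), ℓ x = φ x * x ^ (-α)) ∧
      MonotoneOn ℓ (Set.Ioi 0) ∧
      (∀ x : ℝ, 0 < x → ℓ x⁻¹ = (ℓ x)⁻¹ ∧ 0 < ℓ x) ∧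
      (∃ c : ℝ, 0 < c ∧
        Filter.Tendsto (fun x : ℝ => ℓ x / (c * Real.log x ^ δ)) atTop (𝓝 1)) ∧
      (∀ x : ℝ, 1 ≤ x → ∀ y : ℝ, 0 < y → ℓ (x * y) ≤ ℓ x ^ 2 * ℓ y) := by
  obtain ⟨ε, hε⟩ : ∃ ε : ℝ, ε = (2 - α) * (α - 1) / 14 := ⟨_, rfl⟩
  have hε0 : 0 < ε := by
    rw [hε]; have : 0 < 2 - α := by linarith
    have : 0 < α - 1 := by linarith
    positivity
  obtain ⟨K, hK1, hKδ⟩ : ∃ K : ℝ, 1 ≤ K ∧ δ / K ≤ ε / 2 := by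
    refine ⟨1 + 2 * δ / ε, by have : 0 < 2 * δ / ε := by positivity
                              linarith, ?_⟩
    rw [div_le_iff₀ (by positivity)]
    have : ε / 2 * (1 + 2 * δ / ε) = ε / 2 + δ := by field_simp
    linarith
  have hK0 : 0 < K := by linarith
  have hd0 : 0 < δ / K := by positivity
  have hK2 : δ / K ^ 2 ≤ ε / 2 := by
    refine le_trans ?_ hKδ
    gcongr; nlinarith
  have hK3 : δ / K ^ 3 ≤ ε / 2 := by
    refine le_trans ?_ hKδ
    gcongr; exact le_self_pow₀ hK1 (by norm_num)
  obtain ⟨g, hg⟩ : ∃ g : ℝ → ℝ, g = fun t => δ * Real.arsinh (t / K) := ⟨_, rfl⟩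
  obtain ⟨p, hp⟩ : ∃ g : ℝ → ℝ, g = fun t => δ / K * w (t / K) := ⟨_, rfl⟩
  obtain ⟨q, hq⟩ : ∃ g : ℝ → ℝ, g = fun t => δ / K ^ 2 * (-((t / K) * w (t / K) ^ 3)) := ⟨_, rfl⟩
  obtain ⟨r, hr⟩ : ∃ g : ℝ → ℝ, g = fun t => δ / K ^ 3 *
    (w (t / K) ^ 3 * (3 * ((t / K) ^ 2 * w (t / K) ^ 2) - 1)) := ⟨_, rfl⟩
  have hlin : ∀ t : ℝ, HasDerivAt (fun t => t / K) (1 / K) t := fun t => (hasDerivAt_id t).div_const K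
  have dg : ∀ t, HasDerivAt g (p t) t := by
    intro t
    rw [hg, hp]
    refine (((Real.hasDerivAt_arsinh (t / K)).comp t (hlin t)).const_mul δ).congr_deriv ?_
    simp only [w]; ring
  have dp : ∀ t, HasDerivAt p (q t) t := by
    intro t
    rw [hp, hq]
    refine (((hasDerivAt_w (t / K)).comp t (hlin t)).const_mul (δ / K)).congr_deriv ?_
    field_simp
  have dq : ∀ t, HasDerivAt q (r t) t := by
    intro t
    rw [hq, hr]
    refine (((hasDerivAt_sw (t / K)).comp t (hlin t)).const_mul (δ / K ^ 2)).congr_deriv ?_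
    field_simp
  have bp0 : ∀ t, 0 ≤ p t := by
    intro t; rw [hp]; exact mul_nonneg hd0.le (w_pos _).le
  have bp : ∀ t, p t ≤ ε := by
    intro t; rw [hp]
    have := mul_le_mul_of_nonneg_left (w_le (t / K)) hd0.le
    simp only; linarith
  have bq : ∀ t, |q t| ≤ ε := by
    intro t; rw [hq]
    have h0 : 0 ≤ δ / K ^ 2 := by positivity
    have := mul_le_mul_of_nonneg_left (sw_le (t / K)) h0
    simp only [abs_mul, abs_neg, abs_of_nonneg h0] at this ⊢
    linarith
  have br : ∀ t, r t ≤ ε := by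
    intro t; rw [hr]
    have h0 : 0 ≤ δ / K ^ 3 := by positivity
    have := mul_le_mul_of_nonneg_left (r_le (t / K)) h0
    simp only; linarith
  have hm := fun t => m3_neg α ε (p t) (q t) (r t) hα1 hα2 hε (bp0 t) (bp t) (bq t) (br t)
  have gmono : Monotone g := by
    intro a b hab
    rw [hg]
    have : a / K ≤ b / K := by gcongr
    exact mul_le_mul_of_nonneg_left (Real.arsinh_le_arsinh.2 this) hδ.le
  have g0 : g 0 = 0 := by rw [hg]; simp
  have gneg : ∀ t, g (-t) = - g t := by
    intro t; rw [hg]; simp [neg_div, Real.arsinh_neg]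
  obtain ⟨f, hf⟩ : ∃ f : ℝ → ℝ, f = fun x => x ^ α * Real.exp (g (Real.log x)) := ⟨_, rfl⟩
  obtain ⟨f1, hf1⟩ : ∃ f : ℝ → ℝ, f = fun x => x ^ (α - 1) * Real.exp (g (Real.log x)) *
    (α + p (Real.log x)) := ⟨_, rfl⟩
  obtain ⟨f2, hf2⟩ : ∃ f : ℝ → ℝ, f = fun x => x ^ (α - 2) * Real.exp (g (Real.log x)) *
    ((α - 1 + p (Real.log x)) * (α + p (Real.log x)) + q (Real.log x)) := ⟨_, rfl⟩
  obtain ⟨f3, hf3⟩ : ∃ f : ℝ → ℝ, f = fun x => x ^ (α - 2 - 1) * Real.exp (g (Real.log x)) *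
    ((α - 2 + p (Real.log x)) * ((α - 1 + p (Real.log x)) * (α + p (Real.log x)) + q (Real.log x))
      + ((2 * α - 1 + 2 * p (Real.log x)) * q (Real.log x) + r (Real.log x))) := ⟨_, rfl⟩
  have df : ∀ x, 0 < x → HasDerivAt f (f1 x) x := by
    intro x hx
    have h := key_deriv α g (fun _ => 1) (p (Real.log x)) 0 x hx (dg _) (hasDerivAt_const _ _)
    rw [hf, hf1]
    simpa using h
  have df1 : ∀ x, 0 < x → HasDerivAt f1 (f2 x) x := by
    intro x hx
    have h := key_deriv (α - 1) g (fun t => α + p t) (p (Real.log x)) _ x hx (dg _)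
      ((dp _).const_add α)
    rw [hf1, hf2]
    have e : α - 1 - 1 = α - 2 := by ring
    rw [e] at h
    exact h
  have df2 : ∀ x, 0 < x → HasDerivAt f2 (f3 x) x := by
    intro x hx
    have h := key_deriv (α - 2) g (fun t => (α - 1 + p t) * (α + p t) + q t) (p (Real.log x))
      ((2 * α - 1 + 2 * p (Real.log x)) * q (Real.log x) + r (Real.log x)) x hx (dg _)
      (((((dp _).const_add (α - 1)).mul ((dp _).const_add α)).add (dq _)).congr_deriv (by ring))
    rw [hf2, hf3]
    exact h
  have f1pos : ∀ x, 0 < x → 0 ≤ f1 x := by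
    intro x hx; rw [hf1]
    have := bp0 (Real.log x)
    simp only; positivity
  have f2pos : ∀ x, 0 < x → 0 ≤ f2 x := by
    intro x hx; rw [hf2]
    have := (hm (Real.log x)).1
    simp only; positivity
  have f3neg : ∀ x, 0 < x → f3 x ≤ 0 := by
    intro x hx; rw [hf3]
    have := (hm (Real.log x)).2
    exact mul_nonpos_of_nonneg_of_nonpos (by positivity) this
  have f0 : f 0 = 0 := by rw [hf]; simp [Real.zero_rpow (by linarith : α ≠ 0)]
  have fnn : ∀ x, 0 ≤ x → 0 ≤ f x := by
    intro x hx; rw [hf]; simp only; positivity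
  have fcont : ContinuousOn f (Ici 0) := by
    intro x hx
    rcases eq_or_lt_of_le (show (0:ℝ) ≤ x from hx) with h | h
    · subst h
      unfold ContinuousWithinAt
      rw [f0]
      have hlim : Tendsto (fun x : ℝ => x ^ α) (𝓝[Ici 0] 0) (𝓝 0) := by
        have := (Real.continuousAt_rpow_const 0 α (Or.inr (by linarith))).tendsto
        rw [Real.zero_rpow (by linarith : α ≠ 0)] at this
        exact this.mono_left nhdsWithin_le_nhds
      refine tendsto_of_tendsto_of_tendsto_of_le_of_le' tendsto_const_nhds hlim ?_ ?_
      · filter_upwards [self_mem_nhdsWithin] with y hy using fnn y hy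
      · filter_upwards [self_mem_nhdsWithin, nhdsWithin_le_nhds (Iio_mem_nhds one_pos)] with y hy hy1
        rw [hf]
        have hl : Real.log y ≤ 0 := Real.log_nonpos hy (le_of_lt hy1)
        have : g (Real.log y) ≤ 0 := by rw [← g0]; exact gmono hl
        have h1 : Real.exp (g (Real.log y)) ≤ 1 := Real.exp_le_one_iff.2 this
        exact mul_le_of_le_one_right (Real.rpow_nonneg hy _) h1
    · exact (df x h).continuousAt.continuousWithinAt
  have fmono : MonotoneOn f (Ici 0) := by
    refine monotoneOn_of_deriv_nonneg (convex_Ici 0) fcont ?_ ?_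
    · rw [interior_Ici]; intro x hx; exact (df x hx).differentiableAt.differentiableWithinAt
    · rw [interior_Ici]; intro x hx; rw [(df x hx).deriv]; exact f1pos x hx
  have f1mono : MonotoneOn f1 (Ioi 0) := by
    refine monotoneOn_of_deriv_nonneg (convex_Ioi 0)
      (fun x hx => (df1 x hx).continuousAt.continuousWithinAt) ?_ ?_
    · rw [interior_Ioi]; intro x hx; exact (df1 x hx).differentiableAt.differentiableWithinAt
    · rw [interior_Ioi]; intro x hx; rw [(df1 x hx).deriv]; exact f2pos x hx
  have f2anti : AntitoneOn f2 (Ioi 0) := by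
    refine antitoneOn_of_deriv_nonpos (convex_Ioi 0)
      (fun x hx => (df2 x hx).continuousAt.continuousWithinAt) ?_ ?_
    · rw [interior_Ioi]; intro x hx; exact (df2 x hx).differentiableAt.differentiableWithinAt
    · rw [interior_Ioi]; intro x hx; rw [(df2 x hx).deriv]; exact f3neg x hx
  have fconv : ConvexOn ℝ (Ici 0) f := by
    refine MonotoneOn.convexOn_of_deriv (convex_Ici 0) fcont ?_ ?_
    · rw [interior_Ici]; intro x hx; exact (df x hx).differentiableAt.differentiableWithinAt
    · rw [interior_Ici]; intro x hx y hy hxy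
      rw [(df x hx).deriv, (df y hy).deriv]; exact f1mono hx hy hxy
  have f1conc : ConcaveOn ℝ (Ioi 0) f1 := by
    refine AntitoneOn.concaveOn_of_deriv (convex_Ioi 0)
      (fun x hx => (df1 x hx).continuousAt.continuousWithinAt) ?_ ?_
    · rw [interior_Ioi]; intro x hx; exact (df1 x hx).differentiableAt.differentiableWithinAt
    · rw [interior_Ioi]; intro x hx y hy hxy
      rw [(df1 x hx).deriv, (df1 y hy).deriv]; exact f2anti hx hy hxy
  have himg : (fun x : ℝ => |x|) '' univ = Ici 0 := by
    ext y; constructor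
    · rintro ⟨x, -, rfl⟩; exact abs_nonneg x
    · intro hy; exact ⟨y, trivial, abs_of_nonneg hy⟩
  refine ⟨fun x => f |x|, fun x => Real.exp (g (Real.log x)), fun x => fnn _ (abs_nonneg x),
    fun x => by simp only [abs_neg], ?_, by simp only [abs_zero, f0], ⟨f1, ?_, f1conc⟩, ?_, ?_, ?_, ?_, ?_⟩
  · have habs : ConvexOn ℝ univ (fun x : ℝ => |x|) := by
      exact convexOn_univ_norm (E := ℝ)
    exact ConvexOn.comp (g := f) (f := fun x : ℝ => |x|) (by rw [himg]; exact fconv) habs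
      (by rw [himg]; exact fmono)
  · intro x hx
    refine (df x hx).congr_of_eventuallyEq ?_
    filter_upwards [Ioi_mem_nhds hx] with y hy
    rw [abs_of_pos hy]
  · intro x hx
    have hx : 0 < x := hx
    simp only [hf, abs_of_pos hx]
    rw [Real.rpow_neg hx.le]
    have := (Real.rpow_pos_of_pos hx α).ne'
    field_simp
  · intro x hx y hy hxy
    exact Real.exp_le_exp.2 (gmono (Real.log_le_log hx hxy))
  · intro x hx
    simp only [Real.log_inv, gneg, Real.exp_neg]
    exact ⟨trivial, Real.exp_pos _⟩
  · refine ⟨(2 / K) ^ δ, by positivity, ?_⟩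
    have h1 : Tendsto (fun x : ℝ => Real.log x / K) atTop atTop :=
      Real.tendsto_log_atTop.atTop_div_const hK0
    have h2 := (lim_aux.comp h1).rpow_const (p := δ) (Or.inl one_ne_zero)
    rw [Real.one_rpow] at h2
    refine h2.congr' ?_
    filter_upwards [eventually_gt_atTop 1] with x hx
    have hl : 0 < Real.log x := Real.log_pos hx
    have hy : 0 < Real.log x / K := by positivity
    simp only [Function.comp, hg]
    rw [mul_comm δ, Real.exp_mul, Real.exp_arsinh, ← Real.mul_rpow (by positivity) hl.le,
      ← Real.div_rpow (by positivity) (by positivity)]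
    congr 2
    ring
  · intro x hx y hy
    have hx0 : 0 < x := by linarith
    simp only
    rw [← Real.exp_nat_mul, ← Real.exp_add, Real.exp_le_exp, Real.log_mul hx0.ne' hy.ne', hg]
    have := arsinh_ineq (Real.log x / K) (Real.log y / K) (div_nonneg (Real.log_nonneg hx) hK0.le)
    have := mul_le_mul_of_nonneg_left this hδ.le
    simp only [add_div]
    push_cast
    linarith
end

section
/- For every θ > 0 and η ∈ ℝ, the following are equivalent: (a) there exists p ∈ (1,2] such that (1 − 2e^{−θ}·cos η + e^{−2θ})^{p/2} < 1 − e^{−pθ}; (b) e^{−θ} < cos η. Moreover, in (a) the infimum over p ∈ (1,2] of the left-hand side relative to the right-hand side is achieved at p = 2, i.e. (a) holds if and only if it holds with p = 2. -/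
open Real Set

/-- For every `θ > 0` and `η ∈ ℝ`: there exists `p ∈ (1,2]` with
`(1 - 2e^{-θ} cos η + e^{-2θ})^{p/2} < 1 - e^{-pθ}` if and only if
`e^{-θ} < cos η`; moreover, such a `p` exists if and only if the inequality holds
for `p = 2`. -/
theorem lattice_example_Lambda (θ η : ℝ) (hθ : 0 < θ) :
    ((∃ p ∈ Set.Ioc (1:ℝ) 2,
        (1 - 2 * Real.exp (-θ) * Real.cos η + Real.exp (-2 * θ)) ^ (p / 2)
          < 1 - Real.exp (-(p * θ))) ↔
      Real.exp (-θ) < Real.cos η) ∧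
    ((∃ p ∈ Set.Ioc (1:ℝ) 2,
        (1 - 2 * Real.exp (-θ) * Real.cos η + Real.exp (-2 * θ)) ^ (p / 2)
          < 1 - Real.exp (-(p * θ))) ↔
      (1 - 2 * Real.exp (-θ) * Real.cos η + Real.exp (-2 * θ)) ^ ((2:ℝ) / 2)
        < 1 - Real.exp (-(2 * θ))) := by
  have hx0 : 0 < Real.exp (-θ) := Real.exp_pos _
  have hx1 : Real.exp (-θ) < 1 := Real.exp_lt_one_iff.2 (by linarith)
  have hsq : Real.exp (-2 * θ) = Real.exp (-θ) ^ 2 := by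
    rw [← Real.exp_nat_mul]; congr 1; push_cast; ring
  have hsq' : Real.exp (-(2 * θ)) = Real.exp (-θ) ^ 2 := by
    rw [← hsq]; congr 1; ring
  have hA : 0 < 1 - 2 * Real.exp (-θ) * Real.cos η + Real.exp (-2 * θ) := by
    rw [hsq]
    nlinarith [Real.cos_le_one η, mul_le_mul_of_nonneg_left (Real.cos_le_one η) hx0.le,
      pow_pos (sub_pos.2 hx1) 2]
  have h2 : (1 - 2 * Real.exp (-θ) * Real.cos η + Real.exp (-2 * θ)) ^ ((2:ℝ) / 2)
        < 1 - Real.exp (-(2 * θ)) ↔ Real.exp (-θ) < Real.cos η := by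
    rw [div_self (two_ne_zero), Real.rpow_one, hsq, hsq']
    constructor
    · intro h
      exact lt_of_mul_lt_mul_left (a := Real.exp (-θ)) (by nlinarith) hx0.le
    · intro h
      nlinarith [mul_lt_mul_of_pos_left h hx0]
  have key : (∃ p ∈ Set.Ioc (1:ℝ) 2,
        (1 - 2 * Real.exp (-θ) * Real.cos η + Real.exp (-2 * θ)) ^ (p / 2)
          < 1 - Real.exp (-(p * θ))) ↔
      (1 - 2 * Real.exp (-θ) * Real.cos η + Real.exp (-2 * θ)) ^ ((2:ℝ) / 2)
        < 1 - Real.exp (-(2 * θ)) := by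
    constructor
    · rintro ⟨p, ⟨hp1, hp2⟩, h⟩
      have hA1 : 1 - 2 * Real.exp (-θ) * Real.cos η + Real.exp (-2 * θ) < 1 := by
        by_contra hc
        have := Real.one_le_rpow (not_lt.1 hc) (show 0 ≤ p / 2 by linarith)
        linarith [Real.exp_pos (-(p * θ))]
      have h3 := Real.rpow_le_rpow_of_exponent_ge hA hA1.le
        (show p / 2 ≤ (2:ℝ) / 2 by linarith)
      have h4 : Real.exp (-(2 * θ)) ≤ Real.exp (-(p * θ)) :=
        Real.exp_le_exp.2 (by nlinarith)
      linarith
    · intro h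
      exact ⟨2, ⟨by norm_num, le_refl _⟩, h⟩
  exact ⟨key.trans h2, key⟩
end
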